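/- Let G be a finite group, let A be a commutative unital C*-algebra, let α be a partial action of G on A, and let J be an α-invariant closed two-sided ideal of A admitting a G-invariant approximate identity, i.e., an approximate identity (e_λ) of J such that α_g(e_λ x) = e_λ α_g(x) for all λ, all g ∈ G, and all x ∈ J ∩ A_{g⁻¹}. Let ᾱ denote the induced partial action of G on A/J. Then dim_Rok(α) ≤ dim_Rok(α|_J) + dim_Rok(ᾱ) + 1, where α|_J is the restricted partial action on J. -/

import Mathlib

/-- A partial action of a (discrete) group `G` on a C*-algebra `A`: a family of closed
two-sided (star-closed) ideals `dom g ⊆ A` and *-isomorphisms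
`act g : dom g⁻¹ → dom g` (encoded as total maps, with all axioms stated on the domains),
such that `dom 1 = A`, `act 1 = id`, `act g` maps `dom g⁻¹ ∩ dom h` into `dom g ∩ dom (g*h)`,
and `act (g*h)` extends `act g ∘ act h`. -/
structure CStarPartialAction (G : Type*) [Group G] (A : Type*) [NonUnitalCStarAlgebra A] where
  dom : G → Set A
  act : G → A → A
  dom_isClosed : ∀ g, IsClosed (dom g)
  zero_mem : ∀ g, (0 : A) ∈ dom g
  add_mem : ∀ g, ∀ x ∈ dom g, ∀ y ∈ dom g, x + y ∈ dom g
  smul_mem : ∀ g (c : ℂ), ∀ x ∈ dom g, c • x ∈ dom g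
  mul_mem_left : ∀ g (a : A), ∀ x ∈ dom g, a * x ∈ dom g
  mul_mem_right : ∀ g (a : A), ∀ x ∈ dom g, x * a ∈ dom g
  star_mem : ∀ g, ∀ x ∈ dom g, star x ∈ dom g
  dom_one : dom 1 = Set.univ
  act_one : ∀ x, act 1 x = x
  act_mem : ∀ g, ∀ x ∈ dom g⁻¹, act g x ∈ dom g
  act_add : ∀ g, ∀ x ∈ dom g⁻¹, ∀ y ∈ dom g⁻¹, act g (x + y) = act g x + act g y
  act_smul : ∀ g (c : ℂ), ∀ x ∈ dom g⁻¹, act g (c • x) = c • act g x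
  act_mul : ∀ g, ∀ x ∈ dom g⁻¹, ∀ y ∈ dom g⁻¹, act g (x * y) = act g x * act g y
  act_star : ∀ g, ∀ x ∈ dom g⁻¹, act g (star x) = star (act g x)
  act_inv_act : ∀ g, ∀ x ∈ dom g⁻¹, act g⁻¹ (act g x) = x
  act_surjOn : ∀ g, ∀ y ∈ dom g, ∃ x ∈ dom g⁻¹, act g x = y
  act_inter_mem : ∀ g h, ∀ x ∈ dom g⁻¹ ∩ dom h, act g x ∈ dom g ∩ dom (g * h)
  act_comp : ∀ g h, ∀ x ∈ dom h⁻¹ ∩ dom (g * h)⁻¹, act (g * h) x = act g (act h x)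

/-- A positive contraction in a C*-algebra. -/
def IsPosContraction {A : Type*} [NonUnitalCStarAlgebra A] (f : A) : Prop :=
  (∃ b, f = star b * b) ∧ ‖f‖ ≤ 1

variable {G : Type*} [Group G] [Fintype G] {A : Type*} [NonUnitalCStarAlgebra A]

/-- Conditions (1)–(4) of the definition of Rokhlin dimension, for the tolerance `ε` and
finite set `F`. -/
def RokhlinTowers (α : CStarPartialAction G A) (d : ℕ) (F : Finset A) (ε : ℝ)
    (f : G → Fin (d + 1) → A) : Prop :=
  (∀ g j, f g j ∈ α.dom g ∧ IsPosContraction (f g j)) ∧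
  (∀ g h j, ∀ a ∈ F, ∀ x ∈ F, x ∈ α.dom g⁻¹ →
    ‖(α.act g (f h j * x) - f (g * h) j * α.act g x) * a‖ < ε) ∧
  (∀ j, ∀ g h : G, g ≠ h → ∀ a ∈ F, ‖f g j * f h j * a‖ < ε) ∧
  (∀ a ∈ F, ‖(∑ j : Fin (d + 1), ∑ g : G, f g j) * a - a‖ < ε) ∧
  (∀ g j, ∀ a ∈ F, ∀ b ∈ F, ‖(f g j * b - b * f g j) * a‖ < ε)

/-- Condition (5): approximately commuting towers. -/
def CommutingTowers (d : ℕ) (F : Finset A) (ε : ℝ) (f : G → Fin (d + 1) → A) : Prop :=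
  ∀ g h : G, ∀ j k : Fin (d + 1), ∀ a ∈ F, ‖(f g j * f h k - f h k * f g j) * a‖ < ε

/-- `α` has Rokhlin dimension at most `d`. -/
def HasRokhlinDimLE (α : CStarPartialAction G A) (d : ℕ) : Prop :=
  ∀ ε > (0 : ℝ), ∀ F : Finset A, ∃ f : G → Fin (d + 1) → A, RokhlinTowers α d F ε f

/-- `α` has Rokhlin dimension with commuting towers at most `d`. -/
def HasRokhlinDimCLE (α : CStarPartialAction G A) (d : ℕ) : Prop :=
  ∀ ε > (0 : ℝ), ∀ F : Finset A, ∃ f : G → Fin (d + 1) → A,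
    RokhlinTowers α d F ε f ∧ CommutingTowers d F ε f

/-- The Rokhlin dimension of `α`, as an extended natural number. -/
noncomputable def rokhlinDim (α : CStarPartialAction G A) : ℕ∞ :=
  sInf {n : ℕ∞ | ∃ d : ℕ, n = d ∧ HasRokhlinDimLE α d}

/-- The Rokhlin dimension with commuting towers of `α`. -/
noncomputable def rokhlinDimC (α : CStarPartialAction G A) : ℕ∞ :=
  sInf {n : ℕ∞ | ∃ d : ℕ, n = d ∧ HasRokhlinDimCLE α d}

section Stmt14

variable {G : Type*} [Group G] [Fintype G] {A : Type*} [NonUnitalCStarAlgebra A]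

/-- `dim_Rok(α|_J) ≤ d` for the restriction of `α` to an invariant ideal `J`. -/
def HasIdealRokhlinDimLE (α : CStarPartialAction G A) (J : Set A) (d : ℕ) : Prop :=
  ∀ ε > (0 : ℝ), ∀ F : Finset A, ↑F ⊆ J →
    ∃ f : G → Fin (d + 1) → A, RokhlinTowers α d F ε f ∧ ∀ g j, f g j ∈ J

/-- The Rokhlin dimension of the restricted partial action `α|_J`. -/
noncomputable def idealRokhlinDim (α : CStarPartialAction G A) (J : Set A) : ℕ∞ :=
  sInf {m : ℕ∞ | ∃ d : ℕ, m = d ∧ HasIdealRokhlinDimLE α J d}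

theorem isPosContraction_iff {B : Type*} [NonUnitalCStarAlgebra B] [PartialOrder B]
    [StarOrderedRing B] {f : B} : IsPosContraction f ↔ 0 ≤ f ∧ ‖f‖ ≤ 1 := by
  rw [IsPosContraction, CStarAlgebra.nonneg_iff_eq_star_mul_self]

theorem IsPosContraction.isSelfAdjoint {B : Type*} [NonUnitalCStarAlgebra B] {f : B}
    (hf : IsPosContraction f) : IsSelfAdjoint f := by
  obtain ⟨⟨b, rfl⟩, -⟩ := hf
  exact IsSelfAdjoint.star_mul_self b

theorem IsPosContraction.mul {B : Type*} [CommCStarAlgebra B] {f g : B}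
    (hf : IsPosContraction f) (hg : IsPosContraction g) : IsPosContraction (f * g) := by
  obtain ⟨⟨b, rfl⟩, hf⟩ := hf
  obtain ⟨⟨c, rfl⟩, hg⟩ := hg
  refine ⟨⟨b * c, ?_⟩, (norm_mul_le _ _).trans (mul_le_one₀ hf (norm_nonneg _) hg)⟩
  rw [star_mul]
  ring

theorem IsPosContraction.one_sub {B : Type*} [CommCStarAlgebra B] {f : B}
    (hf : IsPosContraction f) : IsPosContraction (1 - f) := by
  let _ := CStarAlgebra.spectralOrder B
  have _ := CStarAlgebra.spectralOrderedRing B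
  rw [isPosContraction_iff] at hf ⊢
  have h1 : f ≤ 1 := (CStarAlgebra.norm_le_one_iff_of_nonneg f hf.1).1 hf.2
  have h0 : 0 ≤ 1 - f := sub_nonneg.2 h1
  exact ⟨h0, (CStarAlgebra.norm_le_one_iff_of_nonneg _ h0).2 (sub_le_self _ hf.1)⟩

theorem norm_mul_le_of_isPosContraction {B : Type*} [NonUnitalCStarAlgebra B] {f : B}
    (hf : IsPosContraction f) (x : B) : ‖f * x‖ ≤ ‖x‖ :=
  (norm_mul_le _ _).trans (mul_le_of_le_one_left (norm_nonneg _) hf.2)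

open scoped CStarAlgebra in
/-- Positive contractions in the image of a closed subalgebra under a *-homomorphism lift to
positive contractions of the subalgebra. -/
theorem exists_isPosContraction_lift {B C : Type*} [NonUnitalCStarAlgebra B]
    [NonUnitalCStarAlgebra C] (φ : B →⋆ₙₐ[ℂ] C) (S : NonUnitalStarSubalgebra ℂ B)
    (hS : IsClosed (S : Set B)) {h : C} (hh : IsPosContraction h) (hmem : h ∈ φ '' S) :
    ∃ f ∈ S, IsPosContraction f ∧ φ f = h := by
  let _ := CStarAlgebra.spectralOrder B
  have _ := CStarAlgebra.spectralOrderedRing B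
  let _ := CStarAlgebra.spectralOrder C
  have _ := CStarAlgebra.spectralOrderedRing C
  obtain ⟨w, hw, rfl⟩ := hmem
  have hsa : IsSelfAdjoint (φ w) := hh.isSelfAdjoint
  set v : B := (realPart w : B) with hv
  have hvS : v ∈ S := by
    rw [hv, realPart_apply_coe, ← Complex.coe_smul]
    exact SMulMemClass.smul_mem _ (add_mem hw (star_mem hw))
  have hφv : φ v = φ w := by
    rw [hv, realPart_apply_coe, ← Complex.coe_smul, map_smul, map_add, map_star, hsa.star_eq,
      ← two_smul ℂ, smul_smul]
    simp
  have hvsa : IsSelfAdjoint v := (realPart w).2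
  have : IsClosed (S : Set B) := hS
  refine ⟨cfcₙ (fun t : ℝ => max 0 (min 1 t)) v, cfcₙ_mem (𝕜' := ℂ) _ hvS, ?_, ?_⟩
  · rw [isPosContraction_iff]
    refine ⟨cfcₙ_nonneg fun x _ => le_max_left _ _, norm_cfcₙ_le fun x _ => ?_⟩
    rw [Real.norm_of_nonneg (le_max_left _ _)]
    exact max_le zero_le_one (min_le_left _ _)
  · have hφvsa : IsSelfAdjoint (φ v) := hφv ▸ hsa
    rw [NonUnitalStarAlgHom.map_cfcₙ φ _ v, ← hφv]
    conv_rhs => rw [← cfcₙ_id' ℝ (φ v)]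
    refine cfcₙ_congr fun x hx => ?_
    rw [hφv] at hx
    have h0 : 0 ≤ x := quasispectrum_nonneg_of_nonneg _ (isPosContraction_iff.1 hh).1 x hx
    have h1 : ‖x‖ ≤ ‖φ w‖ :=
      NonUnitalIsometricContinuousFunctionalCalculus.norm_quasispectrum_le _ hx hsa
    rw [Real.norm_of_nonneg h0] at h1
    simp [h0, h1.trans hh.2]

open scoped CStarAlgebra in
/-- The norm of the image of a normal element under a *-homomorphism bounds its distance to the
kernel. -/
theorem exists_mem_ker_norm_sub_le {B C : Type*} [NonUnitalCStarAlgebra B]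
    [NonUnitalCStarAlgebra C] (φ : B →⋆ₙₐ[ℂ] C) (y : B) [IsStarNormal y] {δ : ℝ} (hδ : 0 < δ)
    (hy : ‖φ y‖ ≤ δ) : ∃ j, φ j = 0 ∧ ‖y - j‖ ≤ δ := by
  have hφy : IsStarNormal (φ y) := IsStarNormal.map φ y
  set k : ℂ → ℂ := fun z => z * ((δ / max ‖z‖ δ : ℝ) : ℂ) with hk
  have hkc : Continuous k := by
    refine continuous_id.mul (Complex.continuous_ofReal.comp ?_)
    exact continuous_const.div (continuous_norm.max continuous_const)
      fun z => (hδ.trans_le (le_max_right _ _)).ne'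
  have hk0 : k 0 = 0 := by simp [hk]
  refine ⟨y - cfcₙ k y, ?_, ?_⟩
  · rw [map_sub, NonUnitalStarAlgHom.map_cfcₙ φ k y, sub_eq_zero]
    conv_lhs => rw [← cfcₙ_id' ℂ (φ y)]
    refine cfcₙ_congr fun z hz => ?_
    have h1 : ‖z‖ ≤ ‖φ y‖ :=
      NonUnitalIsometricContinuousFunctionalCalculus.norm_quasispectrum_le _ hz hφy
    simp [hk, max_eq_right (h1.trans hy), hδ.ne']
  · rw [sub_sub_cancel]
    refine norm_cfcₙ_le fun z _ => ?_
    have hm : 0 < max ‖z‖ δ := hδ.trans_le (le_max_right _ _)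
    rw [hk, norm_mul, Complex.norm_real, Real.norm_of_nonneg (by positivity), mul_div_assoc',
      div_le_iff₀ hm, mul_comm δ]
    exact mul_le_mul_of_nonneg_right (le_max_left _ _) hδ.le

namespace CStarPartialAction

variable {H : Type*} [Group H] {B : Type*} [NonUnitalCStarAlgebra B] (α : CStarPartialAction H B)

/-- The domain ideals of a partial action, as *-subalgebras. -/
def domSubalgebra (g : H) : NonUnitalStarSubalgebra ℂ B where
  carrier := α.dom g
  add_mem' hx hy := α.add_mem g _ hx _ hy
  zero_mem' := α.zero_mem g
  mul_mem' _ hy := α.mul_mem_left g _ _ hy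
  smul_mem' c _ hx := α.smul_mem g c _ hx
  star_mem' hx := α.star_mem g _ hx

theorem sub_mem {g : H} {x y : B} (hx : x ∈ α.dom g) (hy : y ∈ α.dom g) : x - y ∈ α.dom g := by
  change x - y ∈ α.domSubalgebra g
  exact _root_.sub_mem hx hy

theorem act_sub {g : H} {x y : B} (hx : x ∈ α.dom g⁻¹) (hy : y ∈ α.dom g⁻¹) :
    α.act g (x - y) = α.act g x - α.act g y := by
  rw [eq_sub_iff_add_eq, ← α.act_add g _ (α.sub_mem hx hy) _ hy, sub_add_cancel]

/-- An element of an invariant ideal that commutes with the partial action on the ideal also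
commutes with it on the whole algebra. -/
theorem act_mul_eq_mul_act {B : Type*} [CommCStarAlgebra B] (α : CStarPartialAction H B)
    {J : Set B} (hJadd : ∀ x ∈ J, ∀ y ∈ J, x + y ∈ J) (hJsmul : ∀ (c : ℂ), ∀ x ∈ J, c • x ∈ J)
    (hJmul : ∀ (a : B), ∀ x ∈ J, a * x ∈ J) (hJstar : ∀ x ∈ J, star x ∈ J)
    (hJinv : ∀ g : H, ∀ x ∈ J ∩ α.dom g⁻¹, α.act g x ∈ J) {e : B} (he : e ∈ J)
    (hinv : ∀ g : H, ∀ x ∈ J ∩ α.dom g⁻¹, α.act g (e * x) = e * α.act g x)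
    (g : H) {x : B} (hx : x ∈ α.dom g⁻¹) : α.act g (e * x) = e * α.act g x := by
  have hmulJ (a : B) : e * a ∈ J := mul_comm a e ▸ hJmul a e he
  have hex : e * x ∈ α.dom g⁻¹ := α.mul_mem_left _ _ _ hx
  set D := α.act g (e * x) - e * α.act g x with hD
  have hDdom : D ∈ α.dom g :=
    α.sub_mem (α.act_mem g _ hex) (α.mul_mem_left _ _ _ (α.act_mem g _ hx))
  have hDJ : D ∈ J := by
    rw [hD, sub_eq_add_neg, ← neg_one_smul ℂ (e * _)]
    exact hJadd _ (hJinv g _ ⟨hmulJ x, hex⟩) _ (hJsmul _ _ (hmulJ _))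
  have hDstar : star D ∈ α.dom g⁻¹⁻¹ := by simpa using α.star_mem g _ hDdom
  set z := α.act g⁻¹ (star D) with hz
  have hzJ : z ∈ J := hJinv g⁻¹ _ ⟨hJstar _ hDJ, hDstar⟩
  have hzdom : z ∈ α.dom g⁻¹ := α.act_mem g⁻¹ _ hDstar
  have hgz : α.act g z = star D := by simpa using α.act_inv_act g⁻¹ _ hDstar
  have key : D * star D = 0 := by
    rw [← hgz, hD, sub_mul, ← α.act_mul g _ hex _ hzdom, mul_assoc, mul_assoc,
      hinv g _ ⟨hJmul x z hzJ, α.mul_mem_left _ _ _ hzdom⟩, α.act_mul g _ hx _ hzdom, sub_self]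
  exact sub_eq_zero.1 (CStarRing.mul_star_self_eq_zero_iff D |>.1 key)

end CStarPartialAction

/-- If `e` almost fixes `j`, then multiplication by `1 - e * e` almost reduces the norm of `y` to
its distance from `j`. -/
theorem norm_one_sub_mul_lt {B : Type*} [CommCStarAlgebra B] {e y j : B} (he : IsPosContraction e)
    {δ : ℝ} (hj : ‖y - j‖ ≤ δ) (hej : ‖e * j - j‖ < δ / 2) :
    ‖(1 - e * e) * y‖ < 2 * δ := by
  have h1 : ‖(1 - e * e) * (y - j)‖ ≤ δ :=
    (norm_mul_le_of_isPosContraction (he.mul he).one_sub _).trans hj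
  have h2 : ‖e * (e * j - j)‖ < δ / 2 := (norm_mul_le_of_isPosContraction he _).trans_lt hej
  have h3 : (1 - e * e) * y = (1 - e * e) * (y - j) - (e * (e * j - j) + (e * j - j)) := by ring
  rw [h3]
  have h4 := norm_sub_le ((1 - e * e) * (y - j)) (e * (e * j - j) + (e * j - j))
  have h5 := norm_add_le (e * (e * j - j)) (e * j - j)
  linarith

/-- Towers for an invariant ideal and lifts of towers for the quotient combine to towers for the
whole algebra. -/
theorem hasRokhlinDimLE_of_extension {H : Type*} [Group H] [Fintype H] {B C : Type*}
    [CommCStarAlgebra B] [NonUnitalCStarAlgebra C] (α : CStarPartialAction H B) {J : Set B}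
    (hJadd : ∀ x ∈ J, ∀ y ∈ J, x + y ∈ J) (hJsmul : ∀ (c : ℂ), ∀ x ∈ J, c • x ∈ J)
    (hJmul : ∀ (a : B), ∀ x ∈ J, a * x ∈ J) (hJstar : ∀ x ∈ J, star x ∈ J)
    (hJinv : ∀ g : H, ∀ x ∈ J ∩ α.dom g⁻¹, α.act g x ∈ J)
    (happrox : ∀ ε > (0 : ℝ), ∀ F : Finset B, ↑F ⊆ J → ∃ e ∈ J,
      IsPosContraction e ∧ (∀ x ∈ F, ‖e * x - x‖ < ε) ∧
      (∀ g : H, ∀ x ∈ J ∩ α.dom g⁻¹, α.act g (e * x) = e * α.act g x))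
    (γ : CStarPartialAction H C) (φ : B →⋆ₙₐ[ℂ] C) (hφker : ∀ x, φ x = 0 ↔ x ∈ J)
    (hγdom : ∀ g, γ.dom g = φ '' α.dom g)
    (hγact : ∀ g, ∀ x ∈ α.dom g⁻¹, φ (α.act g x) = γ.act g (φ x)) {m n : ℕ}
    (hm : HasIdealRokhlinDimLE α J m) (hn : HasRokhlinDimLE γ n) :
    HasRokhlinDimLE α (m + n + 1) := by
  classical
  intro ε hε F
  obtain ⟨c, hc, hc1, hc2, hc3, -⟩ := hn (ε / 4) (by positivity) (F.image φ)
  have hlift (g : H) (k : Fin (n + 1)) : ∃ f ∈ α.domSubalgebra g, IsPosContraction f ∧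
      φ f = c g k :=
    exists_isPosContraction_lift φ (α.domSubalgebra g) (α.dom_isClosed g) (hc g k).2
      (hγdom g ▸ (hc g k).1)
  choose h hhdom hhpos hφh using hlift
  set Y₁ : H × H × Fin (n + 1) × B × B → B := fun p =>
    (α.act p.1 (h p.2.1 p.2.2.1 * p.2.2.2.2) - h (p.1 * p.2.1) p.2.2.1 * α.act p.1 p.2.2.2.2) *
      p.2.2.2.1 with hY₁
  set Y₂ : H × H × Fin (n + 1) × B → B := fun p =>
    h p.1 p.2.2.1 * h p.2.1 p.2.2.1 * p.2.2.2 with hY₂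
  set Y₃ : B → B := fun a => (∑ k, ∑ g, h g k) * a - a with hY₃
  have hlow (y : B) : ∃ j ∈ J, ‖φ y‖ < ε / 4 → ‖y - j‖ ≤ ε / 4 := by
    by_cases hy : ‖φ y‖ < ε / 4
    · have : IsStarNormal y := ⟨mul_comm _ _⟩
      obtain ⟨j, hj, hyj⟩ := exists_mem_ker_norm_sub_le φ y (by positivity) hy.le
      exact ⟨j, (hφker j).1 hj, fun _ => hyj⟩
    · exact ⟨0, (hφker 0).1 (map_zero φ), fun h => absurd h hy⟩
  choose low hlowJ hlow using hlow
  set Y : Finset B :=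
    (Finset.univ ×ˢ Finset.univ ×ˢ Finset.univ ×ˢ F ×ˢ F).image Y₁ ∪
      (Finset.univ ×ˢ Finset.univ ×ˢ Finset.univ ×ˢ F).image Y₂ ∪ F.image Y₃ with hY
  obtain ⟨e, heJ, hepos, heY, heinv⟩ := happrox (ε / 4 / 2) (by positivity) (Y.image low) (by
    intro x hx
    obtain ⟨y, -, rfl⟩ := Finset.mem_image.1 (Finset.mem_coe.1 hx)
    exact hlowJ y)
  have hsmall {y : B} (hy : y ∈ Y) (hφy : ‖φ y‖ < ε / 4) : ‖(1 - e * e) * y‖ < ε / 2 := by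
    have := norm_one_sub_mul_lt hepos (hlow y hφy) (heY _ (Finset.mem_image_of_mem low hy))
    linarith
  have hequi (g : H) {x : B} (hx : x ∈ α.dom g⁻¹) : α.act g (e * x) = e * α.act g x :=
    α.act_mul_eq_mul_act hJadd hJsmul hJmul hJstar hJinv heJ heinv g hx
  have hequi₂ (g : H) {x : B} (hx : x ∈ α.dom g⁻¹) :
      α.act g (e * (e * x)) = e * (e * α.act g x) := by
    rw [hequi g (α.mul_mem_left _ _ _ hx), hequi g hx]
  obtain ⟨f, ⟨hf, hf1, hf2, hf3, -⟩, -⟩ := hm (ε / 4) (by positivity) (F.image (e * ·)) (by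
    intro x hx
    obtain ⟨y, -, rfl⟩ := Finset.mem_image.1 (Finset.mem_coe.1 hx)
    exact mul_comm y e ▸ hJmul y e heJ)
  have hmemF {a : B} (ha : a ∈ F) : e * a ∈ F.image (e * ·) := Finset.mem_image_of_mem _ ha
  let σ : Fin (m + n + 1 + 1) ≃ Fin (m + 1) ⊕ Fin (n + 1) :=
    (finCongr (by omega)).trans finSumFinEquiv.symm
  refine ⟨fun g j => Sum.elim (fun i => e * e * f g i) (fun k => (1 - e * e) * h g k) (σ j),
    ?_, ?_, ?_, ?_, ?_⟩
  · intro g j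
    beta_reduce
    rcases σ j with i | k
    · exact ⟨α.mul_mem_left _ _ _ (hf g i).1, (hepos.mul hepos).mul (hf g i).2⟩
    · exact ⟨α.mul_mem_left _ _ _ (hhdom g k), (hepos.mul hepos).one_sub.mul (hhpos g k)⟩
  · intro g g' j a ha x hx hxdom
    beta_reduce
    rcases σ j with i | k
    · have hfx : f g' i * x ∈ α.dom g⁻¹ := α.mul_mem_left _ _ _ hxdom
      have h1 := hf1 g g' i _ (hmemF ha) _ (hmemF hx) (α.mul_mem_left _ _ _ hxdom)
      rw [mul_left_comm (f g' i) e x, hequi g hfx, hequi g hxdom] at h1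
      rw [Sum.elim_inl, Sum.elim_inl]
      rw [mul_assoc, mul_assoc, hequi₂ g hfx]
      have h2 : (e * (e * α.act g (f g' i * x)) - e * e * f (g * g') i * α.act g x) * a =
        (e * α.act g (f g' i * x) - f (g * g') i * (e * α.act g x)) * (e * a) := by ring
      rw [h2]
      linarith
    · have hhx : h g' k * x ∈ α.dom g⁻¹ := α.mul_mem_left _ _ _ hxdom
      have hehx : e * (e * (h g' k * x)) ∈ α.dom g⁻¹ :=
        α.mul_mem_left _ _ _ (α.mul_mem_left _ _ _ hhx)
      rw [Sum.elim_inr, Sum.elim_inr]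
      have h1 : (1 - e * e) * h g' k * x = h g' k * x - e * (e * (h g' k * x)) := by ring
      rw [h1, α.act_sub hhx hehx, hequi₂ g hhx]
      have h2 : (α.act g (h g' k * x) - e * (e * α.act g (h g' k * x)) -
          (1 - e * e) * h (g * g') k * α.act g x) * a =
          (1 - e * e) * Y₁ (g, g', k, a, x) := by
        simp only [hY₁]
        ring
      rw [h2]
      refine (hsmall (by simp only [hY, Finset.mem_union]; left; left; exact
        Finset.mem_image_of_mem _ (by simp [ha, hx])) ?_).trans (by linarith)
      have h3 := hc1 g g' k _ (Finset.mem_image_of_mem φ ha) _ (Finset.mem_image_of_mem φ hx)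
        (hγdom g⁻¹ ▸ Set.mem_image_of_mem φ hxdom)
      simpa only [hY₁, map_mul, map_sub, hγact g _ hhx, hγact g _ hxdom, hφh] using h3
  · intro j g g' hgg a ha
    beta_reduce
    rcases σ j with i | k
    · have h1 := hf2 i g g' hgg _ (hmemF ha)
      rw [Sum.elim_inl, Sum.elim_inl]
      have h2 : e * e * f g i * (e * e * f g' i) * a =
        e * e * (e * (f g i * f g' i * (e * a))) := by ring
      rw [h2]
      exact ((norm_mul_le_of_isPosContraction (hepos.mul hepos) _).trans
        (norm_mul_le_of_isPosContraction hepos _)).trans_lt (h1.trans (by linarith))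
    · simp only [Sum.elim_inr]
      have h2 : (1 - e * e) * h g k * ((1 - e * e) * h g' k) * a =
          (1 - e * e) * ((1 - e * e) * Y₂ (g, g', k, a)) := by
        simp only [hY₂]
        ring
      rw [h2]
      refine (norm_mul_le_of_isPosContraction (hepos.mul hepos).one_sub _).trans_lt
        ((hsmall (by simp only [hY, Finset.mem_union]; left; right; exact
          Finset.mem_image_of_mem _ (by simp [ha])) ?_).trans (by linarith))
      simpa only [hY₂, map_mul, hφh] using hc2 k g g' hgg _ (Finset.mem_image_of_mem φ ha)
  · intro a ha
    rw [← σ.symm.sum_comp, Fintype.sum_sum_type]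
    simp only [Equiv.apply_symm_apply, Sum.elim_inl, Sum.elim_inr, ← Finset.mul_sum]
    have h1 := hf3 _ (hmemF ha)
    have h2 : ‖(1 - e * e) * Y₃ a‖ < ε / 2 := by
      refine hsmall (by simp only [hY, Finset.mem_union]; right; exact
        Finset.mem_image_of_mem _ ha) ?_
      simpa only [hY₃, map_mul, map_sub, map_sum, hφh] using
        hc3 _ (Finset.mem_image_of_mem φ ha)
    have h3 := norm_mul_le_of_isPosContraction hepos ((∑ i, ∑ g, f g i) * (e * a) - e * a)
    have h4 : (e * e * ∑ i, ∑ g, f g i + (1 - e * e) * ∑ k, ∑ g, h g k) * a - a =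
        e * ((∑ i, ∑ g, f g i) * (e * a) - e * a) + (1 - e * e) * Y₃ a := by
      simp only [hY₃]
      ring
    rw [h4]
    exact (norm_add_le _ _).trans_lt (by linarith)
  · intro g j a _ b _
    rw [mul_comm b, sub_self, zero_mul, norm_zero]
    exact hε

/-- Let `α` be a partial action of a finite group `G` on a commutative
unital C*-algebra `A` and `J` an `α`-invariant closed two-sided ideal admitting a
`G`-invariant approximate identity.  If `ᾱ` denotes the induced partial action on `A/J`
(presented by an equivariant surjective *-homomorphism `π : A → C` with kernel `J`), then
`dim_Rok(α) ≤ dim_Rok(α|_J) + dim_Rok(ᾱ) + 1`. -/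
theorem rokhlinDim_le_of_extension {A : Type*} [CommCStarAlgebra A]
    {C : Type*} [NonUnitalCStarAlgebra C]
    (α : CStarPartialAction G A) (J : Set A)
    (hJclosed : IsClosed J) (hJ0 : (0 : A) ∈ J)
    (hJadd : ∀ x ∈ J, ∀ y ∈ J, x + y ∈ J)
    (hJsmul : ∀ (c : ℂ), ∀ x ∈ J, c • x ∈ J)
    (hJmul : ∀ (a : A), ∀ x ∈ J, a * x ∈ J)
    (hJstar : ∀ x ∈ J, star x ∈ J)
    (hJinv : ∀ g : G, ∀ x ∈ J ∩ α.dom g⁻¹, α.act g x ∈ J)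
    -- a `G`-invariant approximate identity for `J`:
    (happrox : ∀ ε > (0 : ℝ), ∀ F : Finset A, ↑F ⊆ J → ∃ e ∈ J,
      IsPosContraction e ∧ (∀ x ∈ F, ‖e * x - x‖ < ε) ∧
      (∀ g : G, ∀ x ∈ J ∩ α.dom g⁻¹, α.act g (e * x) = e * α.act g x))
    -- the induced partial action `γ = ᾱ` on `A/J`, presented via the quotient map `π`:
    (γ : CStarPartialAction G C) (π : A → C)
    (hπadd : ∀ x y, π (x + y) = π x + π y)
    (hπsmul : ∀ (c : ℂ) x, π (c • x) = c • π x)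
    (hπmul : ∀ x y, π (x * y) = π x * π y)
    (hπstar : ∀ x, π (star x) = star (π x))
    (hπsurj : Function.Surjective π)
    (hπker : ∀ x, π x = 0 ↔ x ∈ J)
    (hγdom : ∀ g, γ.dom g = π '' α.dom g)
    (hγact : ∀ g, ∀ x ∈ α.dom g⁻¹, π (α.act g x) = γ.act g (π x)) :
    rokhlinDim α ≤ idealRokhlinDim α J + rokhlinDim γ + 1 := by
  let φ : A →⋆ₙₐ[ℂ] C :=
    { toFun := π
      map_smul' := hπsmul
      map_zero' := (hπker 0).2 hJ0
      map_add' := hπadd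
      map_mul' := hπmul
      map_star' := hπstar }
  rcases Set.eq_empty_or_nonempty {n : ℕ∞ | ∃ d : ℕ, n = d ∧ HasIdealRokhlinDimLE α J d}
    with hm | hm
  · rw [idealRokhlinDim, hm]
    simp
  rcases Set.eq_empty_or_nonempty {n : ℕ∞ | ∃ d : ℕ, n = d ∧ HasRokhlinDimLE γ d} with hn | hn
  · rw [rokhlinDim.eq_1 γ, hn]
    simp
  obtain ⟨m, hm, hmdim⟩ := csInf_mem hm
  obtain ⟨n, hn, hndim⟩ := csInf_mem hn
  rw [idealRokhlinDim, hm, rokhlinDim.eq_1 γ, hn]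
  exact sInf_le ⟨m + n + 1, by push_cast; rfl, hasRokhlinDimLE_of_extension α hJadd hJsmul hJmul
    hJstar hJinv happrox γ φ hπker hγdom hγact hmdim hndim⟩

end Stmt14
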